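/- Let P : {±1}^k → {0,1} be a k-ary Boolean predicate, let t ≥ 2 be an integer, and let ν be a (t−1)-wise uniform distribution on {±1}^k given by a multiset S ⊆ {±1}^k (ν(x) = Pr_{s∼S}[s = x]). Suppose E_{x∼ν}[P(x)] = β > E_{x∼uniform({±1}^k)}[P(x)]. Then for every constant ε > 0 there exist an integer r with r ≤ C(ε,k)·|S|^4 (for some constant C(ε,k)) and a rational ε̃ with 0 ≤ ε̃ ≤ ε, such that there is a (t−1)-wise uniform distribution θ on {±1}^{r×k} with the property that every matrix in the support of θ has exactly (β − ε̃)·r rows that satisfy P. -/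

import Mathlib

open Finset

/-- A distribution `μ` on `ι → Bool` is `j`-wise uniform: its marginal on every set of at most
`j` coordinates is uniform. -/
def kwiseUniform {ι : Type} [Fintype ι] [DecidableEq ι] (j : ℕ) (μ : (ι → Bool) → ℝ) : Prop :=
  ∀ A : Finset ι, A.card ≤ j → ∀ a : ι → Bool,
    ∑ x ∈ Finset.univ.filter (fun x : ι → Bool => ∀ i ∈ A, x i = a i), μ x
      = (1 / 2 : ℝ) ^ A.card

/-- `μ` is a probability distribution on the finite type `α`. -/
def IsDist {α : Type} [Fintype α] (μ : α → ℝ) : Prop :=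
  (∀ x, 0 ≤ μ x) ∧ ∑ x, μ x = 1

/-- A weight whose Gram matrix on a bounded family of functions is entrywise close to the identity
can be reweighted so that all functions but the constant one have mean zero. -/
theorem exists_weight_of_nearly_orthonormal {X ι : Type*} [Fintype X] [Fintype ι] [DecidableEq ι]
    (χ : ι → X → ℝ) (o : ι) (hχ : ∀ A x, |χ A x| ≤ 1) (ho : ∀ x, χ o x = 1)
    (g : X → ℝ) (hg : ∀ x, 0 ≤ g x) (e : ℝ)
    (he : ∀ A B, |∑ x, g x * χ A x * χ B x - if A = B then 1 else 0| ≤ e)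
    (hK : 4 * e * (Fintype.card ι : ℝ) ^ 2 ≤ 1) :
    ∃ w : X → ℝ, (∀ x, 0 ≤ w x) ∧ (∀ x, g x = 0 → w x = 0) ∧
      ∀ B, ∑ x, w x * χ B x = if B = o then 1 else 0 := by
  have e0 : 0 ≤ e := (abs_nonneg _).trans (he o o)
  set K : ℝ := (Fintype.card ι : ℝ) with hKdef
  have K1 : 1 ≤ K := by
    have : 0 < Fintype.card ι := Fintype.card_pos_iff.mpr ⟨o⟩
    exact Nat.one_le_cast.mpr this
  have eK : 4 * (e * K) ≤ 1 := by nlinarith [mul_nonneg e0 (by linarith : (0 : ℝ) ≤ K)]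
  let G : Matrix ι ι ℝ := fun A B => ∑ x, g x * χ A x * χ B x
  have hdet : G.det ≠ 0 := by
    refine det_ne_zero_of_sum_row_lt_diag fun A => ?_
    have h1 : ∑ B ∈ Finset.univ.erase A, ‖G A B‖ ≤ ∑ B ∈ Finset.univ.erase A, e := by
      refine Finset.sum_le_sum fun B hB => ?_
      have := he A B
      rw [if_neg (Finset.ne_of_mem_erase hB).symm, sub_zero] at this
      exact this
    have h2 : 1 - e ≤ ‖G A A‖ := by
      have := he A A
      rw [if_pos rfl] at this
      rw [Real.norm_eq_abs]
      have h3 := (abs_le.mp this).1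
      have := le_abs_self (G A A)
      simp only [G] at *
      linarith
    have h3 : ∑ B ∈ Finset.univ.erase A, e ≤ e * K - e := by
      rw [Finset.sum_const, Finset.card_erase_of_mem (Finset.mem_univ A), Finset.card_univ,
        nsmul_eq_mul, Nat.cast_sub (Fintype.card_pos_iff.mpr ⟨o⟩)]
      push_cast
      linarith
    linarith
  let a : ι → ℝ := G⁻¹.mulVec (fun B => if B = o then 1 else 0)
  have ha : G.mulVec a = fun B => if B = o then 1 else 0 := by
    simp only [a]
    rw [Matrix.mulVec_mulVec, Matrix.mul_nonsing_inv _ (isUnit_iff_ne_zero.mpr hdet),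
      Matrix.one_mulVec]
  have : Nonempty ι := ⟨o⟩
  obtain ⟨A₀, hA₀⟩ := Finite.exists_max fun A => |a A|
  set m := |a A₀|
  have hclose : ∀ B, |a B - if B = o then 1 else 0| ≤ e * K * m := by
    intro B
    have h1 : (∑ A, G B A * a A) = if B = o then 1 else 0 := congrFun ha B
    have h2 : a B - (if B = o then 1 else 0) =
        -∑ A, (G B A - if B = A then 1 else 0) * a A := by
      simp only [sub_mul, Finset.sum_sub_distrib, h1, ite_mul, one_mul, zero_mul,
        Finset.sum_ite_eq, Finset.mem_univ, if_true]
      ring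
    rw [h2, abs_neg]
    calc _ ≤ ∑ A, |(G B A - if B = A then 1 else 0) * a A| := Finset.abs_sum_le_sum_abs _ _
      _ ≤ ∑ _A : ι, e * m := by
        refine Finset.sum_le_sum fun A _ => ?_
        rw [abs_mul]
        exact mul_le_mul (he B A) (hA₀ A) (abs_nonneg _) e0
      _ = e * K * m := by
        rw [Finset.sum_const, Finset.card_univ, nsmul_eq_mul]
        ring
  have hm0 : 0 ≤ m := abs_nonneg _
  have hm : m ≤ 2 := by
    have h1 := hclose A₀
    have h2 : m ≤ |a A₀ - if A₀ = o then 1 else 0| + 1 := by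
      split_ifs
      · have := abs_add_le (a A₀ - 1) 1
        simpa using this
      · simp only [sub_zero]
        linarith
    nlinarith
  refine ⟨fun x => g x * ∑ A, a A * χ A x, fun x => mul_nonneg (hg x) ?_, fun x hx => ?_,
    fun B => ?_⟩
  · have h1 : ∑ A, a A * χ A x = 1 + ∑ A, (a A - if A = o then 1 else 0) * χ A x := by
      simp [sub_mul, Finset.sum_sub_distrib, ho]
    have h2 : |∑ A, (a A - if A = o then 1 else 0) * χ A x| ≤ K * (e * K * m) := by
      calc _ ≤ ∑ A, |(a A - if A = o then 1 else 0) * χ A x| := Finset.abs_sum_le_sum_abs _ _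
        _ ≤ ∑ _A : ι, e * K * m := by
          refine Finset.sum_le_sum fun A _ => ?_
          rw [abs_mul]
          exact (mul_le_of_le_one_right (abs_nonneg _) (hχ A x)).trans (hclose A)
        _ = _ := by rw [Finset.sum_const, Finset.card_univ, nsmul_eq_mul]
    have h3 : K * (e * K * m) ≤ 2 * e * K ^ 2 := by
      have : 0 ≤ e * K ^ 2 := by positivity
      nlinarith
    have := (abs_le.mp h2).1
    rw [h1]
    linarith
  · simp [hx]
  · have h1 : (∑ A, G B A * a A) = if B = o then 1 else 0 := congrFun ha B
    rw [← h1]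
    simp only [G, Finset.mul_sum, Finset.sum_mul]
    rw [Finset.sum_comm]
    refine Finset.sum_congr rfl fun A _ => Finset.sum_congr rfl fun x _ => ?_
    ring

/-- The sum of a product of row statistics over all row permutations depends only on the row sums
of functions of few coordinates. -/
theorem sum_perm_prod_eq_of_sum_eq {r k j : ℕ} {M M' : Fin r → Fin k → Bool}
    (h : ∀ (f : (Fin k → Bool) → ℝ) (T : Finset (Fin k)), DependsOn f (T : Set (Fin k)) →
      T.card ≤ j → ∑ l, f (M l) = ∑ l, f (M' l)) (s : Finset (Fin r)) :
    ∀ (f : Fin r → (Fin k → Bool) → ℝ) (T : Fin r → Finset (Fin k)),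
      (∀ l, DependsOn (f l) (T l : Set (Fin k))) → ∑ l ∈ s, (T l).card ≤ j →
      ∑ σ : Equiv.Perm (Fin r), ∏ l ∈ s, f l (M (σ l)) =
        ∑ σ : Equiv.Perm (Fin r), ∏ l ∈ s, f l (M' (σ l)) := by
  induction s using Finset.induction_on with
  | empty => intros; simp
  | insert a s has ih =>
    intro f T hf hT
    rw [Finset.sum_insert has] at hT
    have key : ∀ N : Fin r → Fin k → Bool,
        ((r - s.card : ℕ) : ℝ) * ∑ σ : Equiv.Perm (Fin r), ∏ l ∈ insert a s, f l (N (σ l)) =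
        (∑ l, f a (N l)) * ∑ σ : Equiv.Perm (Fin r), ∏ l ∈ s, f l (N (σ l)) -
        ∑ b ∈ s, ∑ σ : Equiv.Perm (Fin r),
          ∏ l ∈ s, Function.update f b (f b * f a) l (N (σ l)) := by
      intro N
      have h1 : ∀ b ∈ sᶜ, ∑ σ : Equiv.Perm (Fin r), f a (N (σ b)) * ∏ l ∈ s, f l (N (σ l)) =
          ∑ σ : Equiv.Perm (Fin r), ∏ l ∈ insert a s, f l (N (σ l)) := by
        intro b hb
        rw [Finset.mem_compl] at hb
        refine Fintype.sum_equiv (Equiv.mulRight (Equiv.swap a b)) _ _ fun σ => ?_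
        rw [Finset.prod_insert has]
        congr 1
        · simp
        · refine Finset.prod_congr rfl fun l hl => ?_
          have h2 : Equiv.swap a b l = l :=
            Equiv.swap_apply_of_ne_of_ne (fun e => has (e ▸ hl)) (fun e => hb (e ▸ hl))
          simp [h2]
      have h3 : ∀ b ∈ s, ∑ σ : Equiv.Perm (Fin r),
          ∏ l ∈ s, Function.update f b (f b * f a) l (N (σ l)) =
          ∑ σ : Equiv.Perm (Fin r), f a (N (σ b)) * ∏ l ∈ s, f l (N (σ l)) := by
        intro b hb
        refine Finset.sum_congr rfl fun σ _ => ?_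
        rw [← Finset.mul_prod_erase s _ hb, ← Finset.mul_prod_erase s _ hb,
          Function.update_self, ← mul_assoc, Pi.mul_apply, mul_comm (f b _)]
        congr 1
        refine Finset.prod_congr rfl fun l hl => ?_
        rw [Function.update_of_ne (Finset.ne_of_mem_erase hl)]
      have h4 : ((r - s.card : ℕ) : ℝ) *
          ∑ σ : Equiv.Perm (Fin r), ∏ l ∈ insert a s, f l (N (σ l)) =
          ∑ b ∈ sᶜ, ∑ σ : Equiv.Perm (Fin r), f a (N (σ b)) * ∏ l ∈ s, f l (N (σ l)) := by
        rw [Finset.sum_congr rfl h1, Finset.sum_const, Finset.card_compl, Fintype.card_fin,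
          nsmul_eq_mul]
      rw [h4, Finset.sum_congr rfl h3, eq_sub_iff_add_eq, Finset.sum_compl_add_sum,
        Finset.sum_comm, Finset.mul_sum]
      refine Finset.sum_congr rfl fun σ _ => ?_
      rw [← Finset.sum_mul, Equiv.sum_comp σ fun l => f a (N l)]
    have hcard : s.card < r := by
      have := Finset.card_le_univ (insert a s)
      rw [Finset.card_insert_of_notMem has, Fintype.card_fin] at this
      omega
    have hne : ((r - s.card : ℕ) : ℝ) ≠ 0 := by
      exact_mod_cast (Nat.sub_pos_of_lt hcard).ne'
    refine mul_left_cancel₀ hne ?_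
    rw [key M, key M', h (f a) (T a) (hf a) (by omega), ih f T hf (by omega)]
    congr 1
    refine Finset.sum_congr rfl fun b hb => ?_
    refine ih _ (Function.update T b (T b ∪ T a)) (fun l => ?_) ?_
    · by_cases hl : l = b
      · subst hl
        simp only [Function.update_self]
        intro x y hxy
        simp only [Finset.coe_union, Set.mem_union] at hxy
        rw [Pi.mul_apply, Pi.mul_apply, hf l fun i hi => hxy i (Or.inl hi),
          hf a fun i hi => hxy i (Or.inr hi)]
      · simp only [Function.update_of_ne hl]
        exact hf l
    · rw [← Finset.add_sum_erase s _ hb] at hT ⊢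
      have h1 : ∑ l ∈ s.erase b, (Function.update T b (T b ∪ T a) l).card =
          ∑ l ∈ s.erase b, (T l).card :=
        Finset.sum_congr rfl fun l hl => by
          rw [Function.update_of_ne (Finset.ne_of_mem_erase hl)]
      rw [h1, Function.update_self]
      have := Finset.card_union_le (T b) (T a)
      omega

/-- The number of rows of `M` satisfying `P`. -/
def rowCount {r : ℕ} {X : Type*} (P : X → Bool) (M : Fin r → X) : ℕ :=
  (Finset.univ.filter fun l => P (M l) = true).card

/-- The values of a nontrivial additive character over a non-constant predicate partially cancel,
uniformly over the characters. -/
theorem exists_norm_sum_stdAddChar_le {X : Type*} [Fintype X] (P : X → Bool)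
    (h1 : ∃ x, P x = true) (h0 : ∃ x, P x = false) (D : ℕ) [NeZero D] :
    ∃ ρ : ℝ, 0 ≤ ρ ∧ ρ < 1 ∧ ∀ b : ZMod D, b ≠ 0 →
      ‖∑ x, ZMod.stdAddChar (b * if P x = true then 1 else 0)‖ ≤ ρ * Fintype.card X := by
  obtain ⟨x₁, hx₁⟩ := h1
  obtain ⟨x₀, hx₀⟩ := h0
  have hX : (0 : ℝ) < Fintype.card X := by
    exact_mod_cast Fintype.card_pos_iff.mpr ⟨x₁⟩
  have hlt : ∀ b : ZMod D, b ≠ 0 →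
      ‖∑ x, ZMod.stdAddChar (b * if P x = true then 1 else 0)‖ < Fintype.card X := by
    intro b hb
    have hne : ZMod.stdAddChar b ≠ 1 := by
      intro h
      rw [← (ZMod.stdAddChar (N := D)).map_zero_eq_one] at h
      exact hb (ZMod.injective_stdAddChar h)
    set p : ℕ := (Finset.univ.filter fun x => P x = true).card with hp
    set q : ℕ := (Finset.univ.filter fun x => ¬ P x = true).card with hq
    have hp0 : (0 : ℝ) < p := by
      exact_mod_cast Finset.card_pos.mpr ⟨x₁, by simp [hx₁]⟩
    have hq0 : (0 : ℝ) < q := by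
      exact_mod_cast Finset.card_pos.mpr ⟨x₀, by simp [hx₀]⟩
    have hpq : (p : ℝ) + q = Fintype.card X := by
      have := Finset.card_filter_add_card_filter_not (s := (Finset.univ : Finset X))
        (fun x => P x = true)
      rw [Finset.card_univ] at this
      exact_mod_cast this
    have hsum : ∑ x, ZMod.stdAddChar (b * if P x = true then 1 else 0) =
        (p : ℂ) * ZMod.stdAddChar b + q := by
      have : ∀ x, ZMod.stdAddChar (b * if P x = true then 1 else 0) =
          if P x = true then ZMod.stdAddChar b else 1 := by
        intro x
        split_ifs <;> simp
      simp only [this, Finset.sum_ite, Finset.sum_const, nsmul_eq_mul, mul_one, ← hp, ← hq]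
    have := norm_combo_lt_of_ne (a := (p : ℝ) / Fintype.card X) (b := (q : ℝ) / Fintype.card X)
      (r := 1) (x := ZMod.stdAddChar b) (y := (1 : ℂ)) (by simp) (by simp) hne
      (by positivity) (by positivity) (by rw [← add_div, hpq, div_self hX.ne'])
    have h2 : (p : ℂ) * ZMod.stdAddChar b + q = (Fintype.card X : ℝ) •
        (((p : ℝ) / Fintype.card X) • ZMod.stdAddChar b + ((q : ℝ) / Fintype.card X) • (1 : ℂ)) := by
      rw [smul_add, smul_smul, smul_smul, mul_div_cancel₀ _ hX.ne', mul_div_cancel₀ _ hX.ne']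
      simp
    rw [hsum, h2, norm_smul, Real.norm_of_nonneg hX.le]
    exact mul_lt_of_lt_one_right hX this
  classical
  obtain ⟨b₀, hb₀⟩ := Finite.exists_max fun b : ZMod D => if b = 0 then 0 else
    ‖∑ x, ZMod.stdAddChar (b * if P x = true then 1 else 0)‖ / Fintype.card X
  refine ⟨if b₀ = 0 then 0 else
    ‖∑ x, ZMod.stdAddChar (b₀ * if P x = true then 1 else 0)‖ / Fintype.card X, ?_, ?_,
    fun b hb => ?_⟩
  · split_ifs
    · exact le_rfl
    · positivity
  · split_ifs with h
    · exact one_pos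
    · exact (div_lt_one hX).mpr (hlt b₀ h)
  · have := hb₀ b
    rwa [if_neg hb, div_le_iff₀ hX] at this

/-- Character sums over row tuples decay exponentially in the number of unconstrained rows. -/
theorem norm_sum_prod_stdAddChar_le {X : Type*} [Fintype X] {P : X → Bool} {D : ℕ}
    [NeZero D] {ρ : ℝ} {b : ZMod D}
    (hρ : ‖∑ x, ZMod.stdAddChar (b * if P x = true then 1 else 0)‖ ≤ ρ * Fintype.card X)
    {r : ℕ} (h : Fin r → X → ℝ) (hh : ∀ l x, |h l x| ≤ 1) (s : Finset (Fin r))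
    (hs : ∀ l ∉ s, ∀ x, h l x = 1) :
    ‖∑ M : Fin r → X, ∏ l, ZMod.stdAddChar (b * if P (M l) = true then 1 else 0) *
      (h l (M l) : ℂ)‖ ≤ (Fintype.card X : ℝ) ^ r * ρ ^ (r - s.card) := by
  classical
  rw [← Fintype.prod_sum fun (l : Fin r) x =>
    ZMod.stdAddChar (b * if P x = true then 1 else 0) * (h l x : ℂ), norm_prod]
  calc _ ≤ ∏ l : Fin r, (Fintype.card X : ℝ) * (if l ∈ s then 1 else ρ) := by
        refine Finset.prod_le_prod (fun _ _ => norm_nonneg _) fun l _ => ?_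
        split_ifs with hl
        · calc _ ≤ ∑ x, ‖ZMod.stdAddChar (b * if P x = true then 1 else 0) * (h l x : ℂ)‖ :=
                norm_sum_le _ _
            _ ≤ ∑ _x : X, (1 : ℝ) := by
                refine Finset.sum_le_sum fun x _ => ?_
                rw [norm_mul, AddChar.norm_apply, one_mul, Complex.norm_real]
                exact hh l x
            _ = _ := by simp
        · simp only [hs l hl, Complex.ofReal_one, mul_one]
          linarith
    _ = _ := by
        rw [Finset.prod_mul_distrib, Finset.prod_const, Finset.card_univ, Fintype.card_fin,
          Finset.prod_ite, Finset.prod_const_one, one_mul, Finset.prod_const]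
        congr 2
        rw [Finset.filter_not, Finset.card_sdiff_of_subset (Finset.filter_subset _ _)]
        simp

/-- Fixing the residue of `rowCount P` barely changes the mean of a function of few rows. -/
theorem abs_sum_residue_sub_le {X : Type*} [Fintype X] {P : X → Bool} {D : ℕ}
    [NeZero D] {ρ : ℝ} (hρ0 : 0 ≤ ρ)
    (hρ : ∀ b : ZMod D, b ≠ 0 →
      ‖∑ x, ZMod.stdAddChar (b * if P x = true then 1 else 0)‖ ≤ ρ * Fintype.card X)
    {r : ℕ} (c : ZMod D) (h : Fin r → X → ℝ) (hh : ∀ l x, |h l x| ≤ 1) (s : Finset (Fin r))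
    (hs : ∀ l ∉ s, ∀ x, h l x = 1) :
    |∑ M : Fin r → X, (D : ℝ) * (if (rowCount P M : ZMod D) = c then 1 else 0) * ∏ l, h l (M l) -
      ∑ M : Fin r → X, ∏ l, h l (M l)| ≤ D * ((Fintype.card X : ℝ) ^ r * ρ ^ (r - s.card)) := by
  classical
  have hcount : ∀ M : Fin r → X, (rowCount P M : ZMod D) =
      ∑ l, if P (M l) = true then 1 else 0 := by
    intro M
    simp [rowCount]
  have hind : ∀ M : Fin r → X,
      ((D : ℝ) * (if (rowCount P M : ZMod D) = c then 1 else 0) : ℂ) =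
      ∑ b : ZMod D, ZMod.stdAddChar (-(b * c)) *
        ∏ l, ZMod.stdAddChar (b * if P (M l) = true then 1 else 0) := by
    intro M
    have := AddChar.sum_mulShift ((rowCount P M : ZMod D) - c) (ZMod.isPrimitive_stdAddChar D)
    rw [ZMod.card] at this
    have h2 : ∀ b : ZMod D, ZMod.stdAddChar (-(b * c)) *
        ∏ l, ZMod.stdAddChar (b * if P (M l) = true then 1 else 0) =
        ZMod.stdAddChar (b * ((rowCount P M : ZMod D) - c)) := by
      intro b
      have hP : ∏ l, ZMod.stdAddChar (b * if P (M l) = true then 1 else 0) =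
          ZMod.stdAddChar (∑ l, b * if P (M l) = true then 1 else 0) :=
        (map_prod (ZMod.stdAddChar (N := D)).toMonoidHom
          (fun l => Multiplicative.ofAdd (b * if P (M l) = true then 1 else 0)) Finset.univ).symm
      rw [hP, ← AddChar.map_add_eq_mul, ← Finset.mul_sum, ← hcount]
      congr 1
      ring
    simp only [h2, this, sub_eq_zero]
    split_ifs <;> simp
  have hmain : ((∑ M : Fin r → X, (D : ℝ) * (if (rowCount P M : ZMod D) = c then 1 else 0) *
      ∏ l, h l (M l) - ∑ M : Fin r → X, ∏ l, h l (M l) : ℝ) : ℂ) =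
      ∑ b ∈ Finset.univ.erase (0 : ZMod D), ZMod.stdAddChar (-(b * c)) *
        ∑ M : Fin r → X, ∏ l, ZMod.stdAddChar (b * if P (M l) = true then 1 else 0) *
          (h l (M l) : ℂ) := by
    have h3 : ∑ b : ZMod D, ZMod.stdAddChar (-(b * c)) *
        ∑ M : Fin r → X, ∏ l, ZMod.stdAddChar (b * if P (M l) = true then 1 else 0) *
          (h l (M l) : ℂ) = ∑ M : Fin r → X,
            ((D : ℝ) * (if (rowCount P M : ZMod D) = c then 1 else 0) : ℂ) *
              ∏ l, (h l (M l) : ℂ) := by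
      simp only [hind, Finset.sum_mul, Finset.mul_sum, Finset.prod_mul_distrib]
      rw [Finset.sum_comm]
      simp only [mul_assoc]
    rw [← Finset.add_sum_erase _ _ (Finset.mem_univ (0 : ZMod D))] at h3
    rw [← eq_sub_iff_add_eq'] at h3
    rw [h3]
    push_cast
    simp [apply_ite Complex.ofReal]
  rw [← Real.norm_eq_abs, ← Complex.norm_real, hmain]
  calc _ ≤ ∑ b ∈ Finset.univ.erase (0 : ZMod D), ‖ZMod.stdAddChar (-(b * c)) *
        ∑ M : Fin r → X, ∏ l, ZMod.stdAddChar (b * if P (M l) = true then 1 else 0) *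
          (h l (M l) : ℂ)‖ := norm_sum_le _ _
    _ ≤ ∑ _b ∈ Finset.univ.erase (0 : ZMod D),
        (Fintype.card X : ℝ) ^ r * ρ ^ (r - s.card) := by
      refine Finset.sum_le_sum fun b hb => ?_
      rw [norm_mul, AddChar.norm_apply, one_mul]
      exact norm_sum_prod_stdAddChar_le (hρ b (Finset.ne_of_mem_erase hb)) h hh s hs
    _ ≤ _ := by
      rw [Finset.sum_const, nsmul_eq_mul]
      refine mul_le_mul_of_nonneg_right ?_ (by positivity)
      have : (Finset.univ.erase (0 : ZMod D)).card ≤ D := by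
        refine (Finset.card_le_univ _).trans ?_
        rw [ZMod.card]
      exact_mod_cast this

/-- Chernoff bound for the lower tail of the number of rows equal to `x`. -/
theorem exists_card_rowCount_lt_le {X : Type*} [Fintype X] [DecidableEq X] {η : ℝ}
    (hη0 : 0 < η) (hη1 : η ≤ 1) :
    ∃ ρ : ℝ, 0 ≤ ρ ∧ ρ < 1 ∧ ∀ (x : X) (r : ℕ),
      ((Finset.univ.filter fun M : Fin r → X =>
        (rowCount (fun y => decide (y = x)) M : ℝ) < (1 / Fintype.card X - η) * r).card : ℝ) ≤
      (Fintype.card X : ℝ) ^ r * ρ ^ r := by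
  refine ⟨Real.exp (-(η ^ 2 / 4)), (Real.exp_pos _).le, ?_, fun x r => ?_⟩
  · rw [Real.exp_lt_one_iff]
    have : 0 < η ^ 2 := by positivity
    linarith
  set q : ℝ := (Fintype.card X : ℝ) with hq
  have hq1 : 1 ≤ q := Nat.one_le_cast.mpr (Fintype.card_pos_iff.mpr ⟨x⟩)
  have hmgf : ∑ M : Fin r → X, Real.exp (-(η / 2) * rowCount (fun y => decide (y = x)) M) =
      (q - 1 + Real.exp (-(η / 2))) ^ r := by
    have h1 : ∀ M : Fin r → X, Real.exp (-(η / 2) * rowCount (fun y => decide (y = x)) M) =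
        ∏ l, if M l = x then Real.exp (-(η / 2)) else 1 := by
      intro M
      rw [Finset.prod_ite, Finset.prod_const, Finset.prod_const_one, mul_one, mul_comm,
        Real.exp_nat_mul]
      simp [rowCount]
    simp only [h1]
    rw [← Fintype.prod_sum fun (_ : Fin r) y => if y = x then Real.exp (-(η / 2)) else 1,
      Finset.prod_const, Finset.card_univ, Fintype.card_fin]
    congr 1
    rw [Finset.sum_ite, Finset.filter_eq', if_pos (Finset.mem_univ _), Finset.sum_singleton,
      Finset.sum_const, Finset.filter_ne', Finset.card_erase_of_mem (Finset.mem_univ _),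
      Finset.card_univ, nsmul_eq_mul, Nat.cast_sub (Fintype.card_pos_iff.mpr ⟨x⟩)]
    push_cast
    ring
  have hexp : Real.exp (-(η / 2)) ≤ 1 - η / 2 + (η / 2) ^ 2 := by
    have := Real.abs_exp_sub_one_sub_id_le (x := -(η / 2))
      (by rw [abs_neg, abs_of_nonneg] <;> linarith)
    have := (abs_le.mp this).2
    linarith [neg_sq (η / 2)]
  have hbase : q - 1 + Real.exp (-(η / 2)) ≤
      q * Real.exp (1 / q * (-(η / 2) + (η / 2) ^ 2)) := by
    have h1 := Real.add_one_le_exp (1 / q * (-(η / 2) + (η / 2) ^ 2))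
    have h2 := mul_le_mul_of_nonneg_left h1 (by linarith : 0 ≤ q)
    have h3 : q * (1 / q * (-(η / 2) + (η / 2) ^ 2) + 1) = -(η / 2) + (η / 2) ^ 2 + q := by
      field_simp
    linarith
  have hmarkov : ((Finset.univ.filter fun M : Fin r → X =>
      (rowCount (fun y => decide (y = x)) M : ℝ) < (1 / q - η) * r).card : ℝ) *
      Real.exp (-(η / 2) * ((1 / q - η) * r)) ≤ (q - 1 + Real.exp (-(η / 2))) ^ r := by
    rw [← hmgf, ← nsmul_eq_mul, ← Finset.sum_const]
    refine (Finset.sum_le_sum fun M hM => ?_).trans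
      (Finset.sum_le_univ_sum_of_nonneg fun _ => (Real.exp_pos _).le)
    rw [Real.exp_le_exp]
    have := (Finset.mem_filter.mp hM).2
    nlinarith
  have hpow : (q - 1 + Real.exp (-(η / 2))) ^ r ≤
      q ^ r * Real.exp (1 / q * (-(η / 2) + (η / 2) ^ 2)) ^ r := by
    rw [← mul_pow]
    refine pow_le_pow_left₀ ?_ hbase r
    linarith [Real.exp_pos (-(η / 2))]
  have hfin : Real.exp (1 / q * (-(η / 2) + (η / 2) ^ 2)) ^ r ≤
      Real.exp (-(η ^ 2 / 4)) ^ r * Real.exp (-(η / 2) * ((1 / q - η) * r)) := by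
    rw [← Real.exp_nat_mul, ← Real.exp_nat_mul, ← Real.exp_add, Real.exp_le_exp]
    have h1 : 1 / q ≤ 1 := by
      rw [div_le_one (by linarith)]
      exact hq1
    have h2 : (0 : ℝ) ≤ r := Nat.cast_nonneg r
    have h3 : 0 ≤ r * (η ^ 2 * (1 - 1 / q)) :=
      mul_nonneg h2 (mul_nonneg (sq_nonneg _) (by linarith))
    nlinarith
  have hq0 : (0 : ℝ) ≤ q ^ r := by positivity
  refine le_of_mul_le_mul_right (hmarkov.trans (hpow.trans ?_))
    (Real.exp_pos (-(η / 2) * ((1 / q - η) * r)))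
  rw [mul_assoc]
  exact mul_le_mul_of_nonneg_left hfin hq0

/-- The sign `-1` for `true` and `1` for `false`. -/
def boolSign (b : Bool) : ℝ := if b = true then -1 else 1

/-- The Walsh function of a set of matrix entries. -/
def walsh {r k : ℕ} (A : Finset (Fin r × Fin k)) (M : Fin r → Fin k → Bool) : ℝ :=
  ∏ p ∈ A, boolSign (M p.1 p.2)

theorem abs_boolSign (b : Bool) : |boolSign b| = 1 := by
  cases b <;> simp [boolSign]

theorem boolSign_mul_self (b : Bool) : boolSign b * boolSign b = 1 := by
  cases b <;> simp [boolSign]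

theorem walsh_eq_prod_rows {r k : ℕ} (A : Finset (Fin r × Fin k)) (M : Fin r → Fin k → Bool) :
    walsh A M = ∏ l, ∏ i, if (l, i) ∈ A then boolSign (M l i) else 1 := by
  rw [← Fintype.prod_prod_type' fun l i => if (l, i) ∈ A then boolSign (M l i) else 1]
  simp [walsh, Finset.prod_ite_mem]

theorem abs_walsh {r k : ℕ} (A : Finset (Fin r × Fin k)) (M : Fin r → Fin k → Bool) :
    |walsh A M| = 1 := by
  simp [walsh, Finset.abs_prod, abs_boolSign]

theorem sum_walsh_mul_walsh {r k : ℕ} (A B : Finset (Fin r × Fin k)) :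
    ∑ M, walsh A M * walsh B M = if A = B then ((2 : ℝ) ^ k) ^ r else 0 := by
  split_ifs with h
  · subst h
    have : ∀ M, walsh A M * walsh A M = 1 := by
      intro M
      rw [walsh, ← Finset.prod_mul_distrib]
      simp [boolSign_mul_self]
    simp [this]
  · have h1 : ∀ M, walsh A M * walsh B M = ∏ l, ∏ i,
        ((if (l, i) ∈ A then boolSign (M l i) else 1) *
          (if (l, i) ∈ B then boolSign (M l i) else 1)) := by
      intro M
      simp only [walsh_eq_prod_rows, Finset.prod_mul_distrib]
    simp only [h1]
    rw [← Fintype.prod_sum fun (l : Fin r) (x : Fin k → Bool) => ∏ i,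
        ((if (l, i) ∈ A then boolSign (x i) else 1) *
          (if (l, i) ∈ B then boolSign (x i) else 1))]
    obtain ⟨⟨l, i⟩, hp⟩ : ∃ p, ¬ (p ∈ A ↔ p ∈ B) := by
      by_contra! hc
      exact h (Finset.ext hc)
    refine Finset.prod_eq_zero (Finset.mem_univ l) ?_
    rw [← Fintype.prod_sum fun (i : Fin k) (b : Bool) =>
        ((if (l, i) ∈ A then boolSign b else 1) * (if (l, i) ∈ B then boolSign b else 1))]
    refine Finset.prod_eq_zero (Finset.mem_univ i) ?_
    rw [Fintype.sum_bool]
    by_cases hA : (l, i) ∈ A <;> by_cases hB : (l, i) ∈ B <;> simp_all [boolSign]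

theorem card_finset_card_le {r k j : ℕ} (hr : 0 < r) :
    (Fintype.card {A : Finset (Fin r × Fin k) // A.card ≤ j} : ℝ) ≤
      (j + 1) * ((k + 1 : ℝ) * r) ^ j := by
  have h1 : Fintype.card {A : Finset (Fin r × Fin k) // A.card ≤ j} ≤
      ∑ i ∈ Finset.range (j + 1), (Finset.powersetCard i (Finset.univ : Finset (Fin r × Fin k))).card := by
    rw [Fintype.card_subtype]
    refine (Finset.card_le_card ?_).trans Finset.card_biUnion_le
    intro A hA
    rw [Finset.mem_filter] at hA
    simp only [Finset.mem_biUnion, Finset.mem_range, Finset.mem_powersetCard]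
    exact ⟨A.card, by omega, Finset.subset_univ _, rfl⟩
  have h2 : ∑ i ∈ Finset.range (j + 1),
      (Finset.powersetCard i (Finset.univ : Finset (Fin r × Fin k))).card ≤
      ∑ i ∈ Finset.range (j + 1), ((k + 1) * r) ^ j := by
    refine Finset.sum_le_sum fun i hi => ?_
    rw [Finset.card_powersetCard, Finset.card_univ, Fintype.card_prod, Fintype.card_fin,
      Fintype.card_fin]
    refine (Nat.choose_le_pow _ _).trans ((Nat.pow_le_pow_left (m := (k + 1) * r) ?_ i).trans
      (Nat.pow_le_pow_right (by positivity) ?_))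
    · rw [mul_comm]
      exact Nat.mul_le_mul_right _ (Nat.le_succ k)
    · rw [Finset.mem_range] at hi
      omega
  have h3 := h1.trans h2
  rw [Finset.sum_const, Finset.card_range, smul_eq_mul] at h3
  exact_mod_cast h3

/-- For many rows there is a distribution with uniform marginals on few entries, under which the
number of rows satisfying `P` has a prescribed residue and all rows occur about equally often. -/
theorem eventually_exists_weight (k j : ℕ) (P : (Fin k → Bool) → Bool)
    (h1 : ∃ x, P x = true) (h0 : ∃ x, P x = false) (D : ℕ) [NeZero D] {η : ℝ}
    (hη0 : 0 < η) (hη1 : η ≤ 1) :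
    ∀ᶠ r : ℕ in Filter.atTop, ∀ c : ZMod D, ∃ w : (Fin r → Fin k → Bool) → ℝ,
      (∀ M, 0 ≤ w M) ∧
      (∀ M, w M ≠ 0 → (rowCount P M : ZMod D) = c ∧
        ∀ x, (1 / 2 ^ k - η) * r ≤ rowCount (fun y => decide (y = x)) M) ∧
      ∀ A : Finset (Fin r × Fin k), A.card ≤ j →
        ∑ M, w M * walsh A M = if A = ∅ then 1 else 0 := by
  obtain ⟨ρ₁, hρ₁0, hρ₁1, hρ₁⟩ := exists_norm_sum_stdAddChar_le P h1 h0 D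
  obtain ⟨ρ₂, hρ₂0, hρ₂1, hρ₂⟩ := exists_card_rowCount_lt_le (X := Fin k → Bool) hη0 hη1
  have hcard : (Fintype.card (Fin k → Bool) : ℝ) = 2 ^ k := by simp
  rw [hcard] at hρ₁ hρ₂
  set ρ := max (1 / 2) (max ρ₁ ρ₂) with hρdef
  have hρ0 : 0 < ρ := lt_of_lt_of_le (by norm_num) (le_max_left _ _)
  have hρ1 : ρ < 1 := max_lt (by norm_num) (max_lt hρ₁1 hρ₂1)
  have hle₁ : ρ₁ ≤ ρ := (le_max_left _ _).trans (le_max_right _ _)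
  have hle₂ : ρ₂ ≤ ρ := (le_max_right _ _).trans (le_max_right _ _)
  have hlim : Filter.Tendsto (fun r : ℕ => 4 * (D * (1 + 2 ^ k)) * ((j + 1) ^ 2 *
      (k + 1 : ℝ) ^ (2 * j)) / ρ ^ (2 * j) * ((r : ℝ) ^ (2 * j) * ρ ^ r)) Filter.atTop
      (nhds 0) := by
    have := (tendsto_pow_const_mul_const_pow_of_lt_one (2 * j) hρ0.le hρ1).const_mul
      (4 * (D * (1 + 2 ^ k)) * ((j + 1) ^ 2 * (k + 1 : ℝ) ^ (2 * j)) / ρ ^ (2 * j))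
    rwa [mul_zero] at this
  filter_upwards [hlim.eventually_le_const one_pos, Filter.eventually_ge_atTop (2 * j),
    Filter.eventually_gt_atTop 0] with r hr hr2 hr0 c
  set q : ℝ := (2 : ℝ) ^ k with hq
  have hq0 : 0 < q := by positivity
  let win : (Fin r → Fin k → Bool) → Prop := fun M =>
    ∀ x, (1 / q - η) * r ≤ rowCount (fun y => decide (y = x)) M
  classical
  let res : (Fin r → Fin k → Bool) → ℝ := fun M =>
    (D : ℝ) * (if (rowCount P M : ZMod D) = c then 1 else 0)
  let g : (Fin r → Fin k → Bool) → ℝ := fun M => (if win M then res M else 0) / q ^ r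
  have hres0 : ∀ M, 0 ≤ res M := fun M => by
    simp only [res]
    split_ifs <;> simp
  have hresD : ∀ M, res M ≤ D := fun M => by
    simp only [res]
    split_ifs <;> simp
  have hg0 : ∀ M, 0 ≤ g M := fun M => by
    simp only [g]
    refine div_nonneg ?_ (by positivity)
    split_ifs
    · exact hres0 M
    · exact le_rfl
  have htail : ((Finset.univ.filter fun M => ¬ win M).card : ℝ) ≤ q * (q ^ r * ρ ^ r) := by
    calc ((Finset.univ.filter fun M => ¬ win M).card : ℝ) ≤
        ∑ x : Fin k → Bool, ((Finset.univ.filter fun M : Fin r → Fin k → Bool =>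
          (rowCount (fun y => decide (y = x)) M : ℝ) < (1 / q - η) * r).card : ℝ) := by
          have : (Finset.univ.filter fun M => ¬ win M).card ≤
              ∑ x : Fin k → Bool, (Finset.univ.filter fun M : Fin r → Fin k → Bool =>
                (rowCount (fun y => decide (y = x)) M : ℝ) < (1 / q - η) * r).card := by
            refine (Finset.card_le_card ?_).trans Finset.card_biUnion_le
            intro M hM
            simp only [win, Finset.mem_filter, Finset.mem_univ, true_and, not_forall, not_le,
              Finset.mem_biUnion] at hM ⊢
            exact hM
          exact_mod_cast this
      _ ≤ ∑ _x : Fin k → Bool, q ^ r * ρ ^ r := by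
          refine Finset.sum_le_sum fun x _ => (hρ₂ x r).trans ?_
          exact mul_le_mul_of_nonneg_left (pow_le_pow_left₀ hρ₂0 hle₂ r) (by positivity)
      _ = _ := by
          rw [Finset.sum_const, Finset.card_univ, nsmul_eq_mul, hcard]
  have hgram : ∀ A B : {A : Finset (Fin r × Fin k) // A.card ≤ j},
      |∑ M, g M * walsh A.1 M * walsh B.1 M - if A = B then 1 else 0| ≤
        D * (1 + q) * ρ ^ (r - 2 * j) := by
    intro A B
    let h : Fin r → (Fin k → Bool) → ℝ := fun l x =>
      (∏ i, if (l, i) ∈ A.1 then boolSign (x i) else 1) *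
        (∏ i, if (l, i) ∈ B.1 then boolSign (x i) else 1)
    have hprod : ∀ M, ∏ l, h l (M l) = walsh A.1 M * walsh B.1 M := by
      intro M
      simp only [h, walsh_eq_prod_rows, Finset.prod_mul_distrib]
    have hfac : ∀ (A : Finset (Fin r × Fin k)) l (x : Fin k → Bool),
        |∏ i, if (l, i) ∈ A then boolSign (x i) else 1| = 1 := by
      intro A l x
      rw [Finset.abs_prod]
      refine Finset.prod_eq_one fun i _ => ?_
      split_ifs
      · exact abs_boolSign _
      · exact abs_one
    have hh : ∀ l x, |h l x| ≤ 1 := by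
      intro l x
      simp only [h, abs_mul, hfac, mul_one, le_refl]
    let s : Finset (Fin r) := (A.1 ∪ B.1).image Prod.fst
    have hs : ∀ l ∉ s, ∀ x, h l x = 1 := by
      intro l hl x
      have hA : ∀ i, (l, i) ∉ A.1 := fun i hi =>
        hl (Finset.mem_image.mpr ⟨(l, i), Finset.mem_union_left _ hi, rfl⟩)
      have hB : ∀ i, (l, i) ∉ B.1 := fun i hi =>
        hl (Finset.mem_image.mpr ⟨(l, i), Finset.mem_union_right _ hi, rfl⟩)
      simp [h, hA, hB]
    have hscard : s.card ≤ 2 * j := by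
      have h2 : s.card ≤ (A.1 ∪ B.1).card := Finset.card_image_le
      have h3 := Finset.card_union_le A.1 B.1
      have := A.2
      have := B.2
      omega
    have hR := abs_sum_residue_sub_le hρ₁0 (by rwa [hcard]) c h hh s hs
    simp only [hprod, sum_walsh_mul_walsh, hcard] at hR
    have hdiff : |∑ M, (if win M then 0 else res M) * (walsh A.1 M * walsh B.1 M)| ≤
        D * (q * (q ^ r * ρ ^ r)) := by
      calc _ ≤ ∑ M, |(if win M then 0 else res M) * (walsh A.1 M * walsh B.1 M)| :=
            Finset.abs_sum_le_sum_abs _ _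
        _ ≤ ∑ M, if ¬ win M then (D : ℝ) else 0 := by
            refine Finset.sum_le_sum fun M _ => ?_
            rw [abs_mul, abs_mul, abs_walsh, abs_walsh, mul_one, mul_one]
            by_cases hM : win M
            · simp [hM]
            · simp only [hM, if_false, not_false_eq_true, if_true]
              rw [abs_of_nonneg (hres0 M)]
              exact hresD M
        _ = D * ((Finset.univ.filter fun M => ¬ win M).card : ℝ) := by
            rw [← Finset.sum_filter, Finset.sum_const, nsmul_eq_mul, mul_comm]
        _ ≤ _ := mul_le_mul_of_nonneg_left htail (Nat.cast_nonneg D)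
    have hsplit : ∑ M, g M * walsh A.1 M * walsh B.1 M - (if A = B then 1 else 0) =
        ((∑ M, res M * (walsh A.1 M * walsh B.1 M) - if A.1 = B.1 then q ^ r else 0) -
          ∑ M, (if win M then 0 else res M) * (walsh A.1 M * walsh B.1 M)) / q ^ r := by
      have hqr : q ^ r ≠ 0 := by positivity
      rw [sub_right_comm, ← Finset.sum_sub_distrib, sub_div, Finset.sum_div]
      congr 1
      · refine Finset.sum_congr rfl fun M _ => ?_
        simp only [g]
        split_ifs <;> ring
      · by_cases hAB : A = B
        · simp [hAB, hqr]
        · simp [hAB, Subtype.ext_iff.not.mp hAB]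
    have hpow₁ : ρ₁ ^ (r - s.card) ≤ ρ ^ (r - 2 * j) :=
      (pow_le_pow_left₀ hρ₁0 hle₁ _).trans
        (pow_le_pow_of_le_one hρ0.le hρ1.le (Nat.sub_le_sub_left hscard r))
    have hpow₂ : ρ ^ r ≤ ρ ^ (r - 2 * j) :=
      pow_le_pow_of_le_one hρ0.le hρ1.le (Nat.sub_le _ _)
    have hqr : 0 < q ^ r := by positivity
    have hD : (0 : ℝ) ≤ D := Nat.cast_nonneg D
    rw [hsplit, abs_div, abs_of_pos hqr, div_le_iff₀ hqr]
    calc _ ≤ D * (q ^ r * ρ₁ ^ (r - s.card)) + D * (q * (q ^ r * ρ ^ r)) :=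
          (abs_sub _ _).trans (add_le_add hR hdiff)
      _ ≤ D * (q ^ r * ρ ^ (r - 2 * j)) + D * (q * (q ^ r * ρ ^ (r - 2 * j))) := by gcongr
      _ = _ := by ring
  have hK : 4 * (D * (1 + q) * ρ ^ (r - 2 * j)) *
      (Fintype.card {A : Finset (Fin r × Fin k) // A.card ≤ j} : ℝ) ^ 2 ≤ 1 := by
    refine le_trans ?_ hr
    have h2 := card_finset_card_le (k := k) (j := j) hr0
    have h3 : ρ ^ (r - 2 * j) = ρ ^ r / ρ ^ (2 * j) := by
      rw [pow_sub₀ _ hρ0.ne' hr2, div_eq_mul_inv]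
    calc _ ≤ 4 * (D * (1 + q) * ρ ^ (r - 2 * j)) *
          ((j + 1) * ((k + 1 : ℝ) * r) ^ j) ^ 2 := by gcongr
      _ = _ := by
        rw [h3, mul_pow (k + 1 : ℝ) (r : ℝ) j]
        ring
  obtain ⟨w, hw0, hwg, hw⟩ := exists_weight_of_nearly_orthonormal
    (fun A : {A : Finset (Fin r × Fin k) // A.card ≤ j} => walsh A.1) ⟨∅, by simp⟩
    (fun A M => (abs_walsh A.1 M).le) (fun M => by simp [walsh]) g hg0 _ hgram hK
  refine ⟨w, hw0, fun M hM => ?_, fun A hA => ?_⟩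
  · have hgM : g M ≠ 0 := fun h => hM (hwg M h)
    by_cases hwin : win M
    · refine ⟨?_, hwin⟩
      by_contra hc
      exact hgM (by simp [g, res, hc])
    · exact absurd (by simp [g, hwin]) hgM
  · exact (hw ⟨A, hA⟩).trans (if_congr Subtype.ext_iff rfl rfl)

theorem ite_forall_mem_eq_prod {ι : Type*} (A : Finset ι) (p : ι → Prop) [DecidablePred p]
    [Decidable (∀ i ∈ A, p i)] :
    (if ∀ i ∈ A, p i then (1 : ℝ) else 0) = ∏ i ∈ A, if p i then 1 else 0 := by
  split_ifs with h
  · exact (Finset.prod_eq_one fun i hi => if_pos (h i hi)).symm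
  · push Not at h
    obtain ⟨i, hi, hne⟩ := h
    exact (Finset.prod_eq_zero hi (if_neg hne)).symm

theorem indicator_eq_sum_walsh {r k : ℕ} (A : Finset (Fin r × Fin k)) (a : Fin r × Fin k → Bool)
    (M : Fin r → Fin k → Bool) :
    (if ∀ p ∈ A, M p.1 p.2 = a p then (1 : ℝ) else 0) =
      ∑ B ∈ A.powerset, (1 / 2) ^ A.card * (∏ p ∈ B, boolSign (a p)) * walsh B M := by
  have h1 : ∀ b c : Bool, (if b = c then (1 : ℝ) else 0) =
      1 / 2 * (1 + boolSign c * boolSign b) := by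
    intro b c
    cases b <;> cases c <;> norm_num [boolSign]
  rw [ite_forall_mem_eq_prod]
  simp only [h1]
  rw [Finset.prod_mul_distrib, Finset.prod_const, Finset.prod_one_add, Finset.mul_sum]
  refine Finset.sum_congr rfl fun B _ => ?_
  rw [Finset.prod_mul_distrib, walsh, mul_assoc]

theorem sum_mul_indicator_of_walsh {r k j : ℕ} {w : (Fin r → Fin k → Bool) → ℝ}
    (hw : ∀ A : Finset (Fin r × Fin k), A.card ≤ j →
      ∑ M, w M * walsh A M = if A = ∅ then 1 else 0)
    {A : Finset (Fin r × Fin k)} (hA : A.card ≤ j) (a : Fin r × Fin k → Bool) :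
    ∑ M, w M * (if ∀ p ∈ A, M p.1 p.2 = a p then 1 else 0) = (1 / 2 : ℝ) ^ A.card := by
  simp only [indicator_eq_sum_walsh, Finset.mul_sum]
  rw [Finset.sum_comm]
  have h1 : ∀ B ∈ A.powerset,
      ∑ M, w M * ((1 / 2) ^ A.card * (∏ p ∈ B, boolSign (a p)) * walsh B M) =
      if B = ∅ then (1 / 2 : ℝ) ^ A.card else 0 := by
    intro B hB
    have := hw B ((Finset.card_le_card (Finset.mem_powerset.mp hB)).trans hA)
    calc _ = ∑ M, ((1 / 2) ^ A.card * (∏ p ∈ B, boolSign (a p))) * (w M * walsh B M) :=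
          Finset.sum_congr rfl fun M _ => by ring
      _ = _ := by
          rw [← Finset.mul_sum, this]
          split_ifs with h
          · simp [h]
          · simp
  rw [Finset.sum_congr rfl h1]
  simp

theorem sum_perm_indicator_eq {r k j : ℕ} {M M' : Fin r → Fin k → Bool}
    (h : ∀ (f : (Fin k → Bool) → ℝ) (T : Finset (Fin k)), DependsOn f (T : Set (Fin k)) →
      T.card ≤ j → ∑ l, f (M l) = ∑ l, f (M' l))
    {A : Finset (Fin r × Fin k)} (hA : A.card ≤ j) (a : Fin r × Fin k → Bool) :
    ∑ σ : Equiv.Perm (Fin r), (if ∀ p ∈ A, M (σ p.1) p.2 = a p then (1 : ℝ) else 0) =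
      ∑ σ : Equiv.Perm (Fin r), (if ∀ p ∈ A, M' (σ p.1) p.2 = a p then (1 : ℝ) else 0) := by
  have h1 : ∀ (N : Fin r → Fin k → Bool),
      (if ∀ p ∈ A, N p.1 p.2 = a p then (1 : ℝ) else 0) =
      ∏ l, ∏ i, if (l, i) ∈ A then (if N l i = a (l, i) then 1 else 0) else 1 := by
    intro N
    rw [← Fintype.prod_prod_type' fun l i =>
      if (l, i) ∈ A then (if N l i = a (l, i) then (1 : ℝ) else 0) else 1,
      ite_forall_mem_eq_prod]
    simp [Finset.prod_ite_mem]
  have h2 := sum_perm_prod_eq_of_sum_eq h Finset.univ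
    (fun l x => ∏ i, if (l, i) ∈ A then (if x i = a (l, i) then 1 else 0) else 1)
    (fun l => Finset.univ.filter fun i => (l, i) ∈ A) (fun l x y hxy => ?_) ?_
  · calc _ = _ := Finset.sum_congr rfl fun σ _ => h1 fun l => M (σ l)
      _ = _ := h2
      _ = _ := (Finset.sum_congr rfl fun σ _ => h1 fun l => M' (σ l)).symm
  · refine Finset.prod_congr rfl fun i _ => ?_
    split_ifs with hi h3 h4 h4
    all_goals first | rfl | skip
    all_goals
      have := hxy i (by simpa using hi)
      simp_all
  · refine le_trans (le_of_eq ?_) hA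
    simp only [Finset.card_filter]
    rw [← Fintype.sum_prod_type' fun l i => if (l, i) ∈ A then 1 else 0]
    simp

theorem sum_perm_mul_indicator {r k j : ℕ} {w : (Fin r → Fin k → Bool) → ℝ}
    (hw : ∀ A : Finset (Fin r × Fin k), A.card ≤ j →
      ∑ M, w M * walsh A M = if A = ∅ then 1 else 0)
    {A : Finset (Fin r × Fin k)} (hA : A.card ≤ j) (a : Fin r × Fin k → Bool)
    (σ : Equiv.Perm (Fin r)) :
    ∑ M, w M * (if ∀ p ∈ A, M (σ p.1) p.2 = a p then 1 else 0) = (1 / 2 : ℝ) ^ A.card := by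
  let τ : Fin r × Fin k ≃ Fin r × Fin k := Equiv.prodCongr σ (Equiv.refl _)
  have := sum_mul_indicator_of_walsh hw (A := A.map τ.toEmbedding) (by simpa using hA)
    (fun p => a (τ.symm p))
  rw [Finset.card_map] at this
  rw [← this]
  refine Finset.sum_congr rfl fun M _ => ?_
  congr 1
  refine if_congr ?_ rfl rfl
  rw [Finset.forall_mem_map]
  simp [τ]

/-- A function on the index set with prescribed multiplicities. -/
theorem exists_sum_comp_eq {X : Type*} [Fintype X] {r : ℕ} (n : X → ℕ) (hn : ∑ x, n x = r) :
    ∃ M : Fin r → X, ∀ f : X → ℝ, ∑ l, f (M l) = ∑ x, n x * f x := by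
  have e : Fin r ≃ Σ x, Fin (n x) := by
    refine Fintype.equivOfCardEq ?_
    simp [hn]
  refine ⟨fun l => (e l).1, fun f => ?_⟩
  rw [Equiv.sum_comp e fun y => f y.1, Fintype.sum_sigma]
  simp

theorem sum_comp_eq_sum_rowCount {X : Type*} [Fintype X] [DecidableEq X] {r : ℕ} (M : Fin r → X)
    (f : X → ℝ) : ∑ l, f (M l) = ∑ x, rowCount (fun y => decide (y = x)) M * f x := by
  rw [← Finset.sum_fiberwise Finset.univ M fun l => f (M l)]
  refine Finset.sum_congr rfl fun x _ => ?_
  rw [Finset.sum_congr rfl fun l hl => by rw [(Finset.mem_filter.mp hl).2], Finset.sum_const,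
    nsmul_eq_mul]
  simp [rowCount]

theorem rowCount_eq_sum {X : Type*} {r : ℕ} (P : X → Bool) (M : Fin r → X) :
    (rowCount P M : ℝ) = ∑ l, if P (M l) = true then 1 else 0 := by
  simp [rowCount]

/-- Functions of few coordinates have the same mean under a `j`-wise uniform weight as under the
uniform distribution. -/
theorem kwiseUniform.sum_mul_eq {k j : ℕ} {μ : (Fin k → Bool) → ℝ} (hμ : kwiseUniform j μ)
    {f : (Fin k → Bool) → ℝ} {T : Finset (Fin k)} (hf : DependsOn f (T : Set (Fin k)))
    (hT : T.card ≤ j) : 2 ^ k * ∑ x, μ x * f x = ∑ x, f x := by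
  have hcount : ∀ x : Fin k → Bool,
      ((Finset.univ.filter fun y : Fin k → Bool => ∀ i ∈ T, x i = y i).card : ℝ) * 2 ^ T.card =
        2 ^ k := by
    intro x
    have h1 : (Finset.univ.filter fun y : Fin k → Bool => ∀ i ∈ T, x i = y i) =
        Fintype.piFinset fun i => if i ∈ T then {x i} else Finset.univ := by
      ext y
      simp only [Finset.mem_filter, Finset.mem_univ, true_and, Fintype.mem_piFinset]
      refine forall_congr' fun i => ?_
      by_cases hi : i ∈ T
      · simpa [hi] using eq_comm
      · simp [hi]
    rw [h1, Fintype.card_piFinset]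
    have h2 : ∀ i, (if i ∈ T then {x i} else (Finset.univ : Finset Bool)).card =
        if i ∈ T then 1 else 2 := by
      intro i
      split_ifs <;> simp
    simp only [h2]
    have h3 : (2 : ℝ) ^ T.card = ∏ i : Fin k, if i ∈ T then 2 else 1 := by
      simp [Finset.prod_ite_mem]
    rw [h3]
    push_cast
    rw [← Finset.prod_mul_distrib]
    have h4 : ∀ i : Fin k, (if i ∈ T then (1 : ℝ) else 2) * (if i ∈ T then 2 else 1) = 2 := by
      intro i
      split_ifs <;> norm_num
    simp [h4]
  have hsum : ∑ x, ∑ y, (if ∀ i ∈ T, x i = y i then μ x * f y else 0) =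
      (1 / 2 : ℝ) ^ T.card * ∑ y, f y := by
    rw [Finset.sum_comm, Finset.mul_sum]
    refine Finset.sum_congr rfl fun y _ => ?_
    rw [← Finset.sum_filter, ← Finset.sum_mul]
    congr 1
    convert hμ T hT y
  have hsum' : ∑ x, ∑ y, (if ∀ i ∈ T, x i = y i then μ x * f y else 0) * 2 ^ T.card =
      2 ^ k * ∑ x, μ x * f x := by
    rw [Finset.mul_sum]
    refine Finset.sum_congr rfl fun x _ => ?_
    rw [← hcount x, ← Finset.sum_mul, ← Finset.sum_filter]
    rw [Finset.sum_congr rfl fun y hy => by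
      rw [← hf (x := x) (y := y) fun i hi => (Finset.mem_filter.mp hy).2 i hi], Finset.sum_const,
      nsmul_eq_mul]
    ring
  rw [← hsum']
  simp only [← Finset.sum_mul]
  rw [hsum, mul_right_comm, ← mul_pow]
  norm_num

/-- Averaging over row permutations turns a weight with vanishing low-degree Walsh coefficients,
moved along `Φ` without changing low-degree row sums, into a `j`-wise uniform distribution. -/
theorem exists_kwiseUniform_of_rearrangement {r k j : ℕ} {w : (Fin r → Fin k → Bool) → ℝ}
    (hw0 : ∀ M, 0 ≤ w M)
    (hw : ∀ A : Finset (Fin r × Fin k), A.card ≤ j →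
      ∑ M, w M * walsh A M = if A = ∅ then 1 else 0)
    (P : (Fin k → Bool) → Bool) (m : ℕ)
    (h : ∀ M, w M ≠ 0 → ∃ M' : Fin r → Fin k → Bool, rowCount P M' = m ∧
      ∀ (f : (Fin k → Bool) → ℝ) (T : Finset (Fin k)), DependsOn f (T : Set (Fin k)) →
        T.card ≤ j → ∑ l, f (M l) = ∑ l, f (M' l)) :
    ∃ θ : (Fin r × Fin k → Bool) → ℝ, IsDist θ ∧ kwiseUniform j θ ∧
      ∀ M : Fin r × Fin k → Bool, θ M ≠ 0 →
        (Finset.univ.filter fun l : Fin r => P (fun i => M (l, i)) = true).card = m := by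
  have h' : ∀ M, ∃ M' : Fin r → Fin k → Bool, w M ≠ 0 → rowCount P M' = m ∧
      ∀ (f : (Fin k → Bool) → ℝ) (T : Finset (Fin k)), DependsOn f (T : Set (Fin k)) →
        T.card ≤ j → ∑ l, f (M l) = ∑ l, f (M' l) := by
    intro M
    by_cases hM : w M = 0
    · exact ⟨M, fun hM' => absurd hM hM'⟩
    · obtain ⟨M', hM'⟩ := h M hM
      exact ⟨M', fun _ => hM'⟩
  choose Φ hΦ using h'
  have hr : ((Fintype.card (Equiv.Perm (Fin r)) : ℕ) : ℝ) ≠ 0 := by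
    exact_mod_cast Fintype.card_ne_zero
  let θ : (Fin r × Fin k → Bool) → ℝ := fun M => ∑ N, w N *
    ((Fintype.card (Equiv.Perm (Fin r)) : ℝ)⁻¹ * ∑ σ : Equiv.Perm (Fin r),
      if M = fun p => Φ N (σ p.1) p.2 then 1 else 0)
  have hθ0 : ∀ M, 0 ≤ θ M := fun M => Finset.sum_nonneg fun N _ =>
    mul_nonneg (hw0 N) (mul_nonneg (by positivity) (Finset.sum_nonneg fun σ _ => by
      split_ifs <;> norm_num))
  have huni : kwiseUniform j θ := by
    intro A hA a
    simp only [θ]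
    rw [Finset.sum_comm]
    have h1 : ∀ N, ∑ M ∈ Finset.univ.filter (fun x : Fin r × Fin k → Bool => ∀ i ∈ A, x i = a i),
        w N * ((Fintype.card (Equiv.Perm (Fin r)) : ℝ)⁻¹ * ∑ σ : Equiv.Perm (Fin r),
          if M = fun p => Φ N (σ p.1) p.2 then (1 : ℝ) else 0) =
        (Fintype.card (Equiv.Perm (Fin r)) : ℝ)⁻¹ * ∑ σ : Equiv.Perm (Fin r),
          w N * (if ∀ p ∈ A, N (σ p.1) p.2 = a p then 1 else 0) := by
      intro N
      rw [← Finset.mul_sum, ← Finset.mul_sum, ← Finset.mul_sum, Finset.sum_comm]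
      by_cases hN : w N = 0
      · simp [hN]
      · rw [sum_perm_indicator_eq (hΦ N hN).2 hA a, mul_left_comm]
        congr 2
        refine Finset.sum_congr rfl fun σ _ => ?_
        rw [Finset.sum_ite_eq']
        simp
    rw [Finset.sum_congr rfl fun N _ => h1 N, ← Finset.mul_sum, Finset.sum_comm,
      Finset.sum_congr rfl fun σ _ => sum_perm_mul_indicator hw hA a σ, Finset.sum_const,
      Finset.card_univ, nsmul_eq_mul, inv_mul_cancel_left₀ hr]
  refine ⟨θ, ⟨hθ0, ?_⟩, huni, fun M hM => ?_⟩
  · simpa using huni ∅ (by simp) (fun _ => false)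
  · simp only [θ] at hM
    obtain ⟨N, -, hN⟩ := Finset.exists_ne_zero_of_sum_ne_zero hM
    have hsum := right_ne_zero_of_mul (right_ne_zero_of_mul hN)
    obtain ⟨σ, -, hσ⟩ := Finset.exists_ne_zero_of_sum_ne_zero hsum
    have hMσ : M = fun p => Φ N (σ p.1) p.2 := by
      by_contra hne
      exact hσ (if_neg hne)
    rw [← (hΦ N (left_ne_zero_of_mul hN)).1, hMσ, rowCount]
    refine Finset.card_equiv σ fun l => ?_
    simp

theorem shifted_multiplicity_nonneg {q a u γ β η r n c z d : ℝ} (hq : 1 ≤ q)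
    (hu : 0 ≤ u) (huγ : u ≤ γ) (hγβ : γ < β) (hβ : β ≤ 1) (hη : η = (β - γ) / (2 * q ^ 2))
    (hr : 0 ≤ r) (hn : (1 / q - η) * r ≤ n) (hc1 : (u - q * η) * r ≤ c)
    (hc2 : c ≤ (u + q * η) * r) (hz : z * (q * a * (β - u)) = γ * r - c) (hd1 : -a ≤ d)
    (hd2 : d ≤ q * a) : 0 ≤ n + z * d := by
  have hq0 : 0 < q := by linarith
  have hqη : q ^ 2 * η = (β - γ) / 2 := by
    rw [hη]
    field_simp
  have hη0 : 0 < η := by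
    rw [hη]
    exact div_pos (by linarith) (by positivity)
  have hqη' : q * η ≤ (β - γ) / 2 := by nlinarith [mul_pos hq0 hη0]
  have hbu : 0 < q * (β - u) := mul_pos hq0 (by linarith)
  have hexp : (1 / q - η) * r * (q * (β - u)) = (1 - q * η) * (β - u) * r := by
    field_simp
  have hqη0 : 0 < q * η := mul_pos hq0 hη0
  rcases le_or_gt 0 z with h | h
  · have h1 : z * a ≤ (1 / q - η) * r := by
      refine le_of_mul_le_mul_right ?_ hbu
      rw [hexp]
      have h2 : γ - u + q * η ≤ (1 - q * η) * (β - u) := by nlinarith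
      nlinarith [mul_le_mul_of_nonneg_right h2 hr]
    nlinarith [mul_le_mul_of_nonneg_left hd1 h]
  · have h1 : -z * (q * a) ≤ (1 / q - η) * r := by
      refine le_of_mul_le_mul_right ?_ hbu
      rw [hexp]
      have h2 : q * (q * η) ≤ (1 - q * η) * (β - u) := by nlinarith
      have h3 : -z * (q * a) * (β - u) ≤ q * η * r := by
        nlinarith [mul_le_mul_of_nonneg_right huγ hr]
      have h4 := mul_le_mul_of_nonneg_left h3 hq0.le
      nlinarith [mul_le_mul_of_nonneg_right h2 hr]
    nlinarith [mul_le_mul_of_nonneg_left hd2 (neg_nonneg.mpr h.le)]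

/-- Some `j`-wise uniform distribution on matrices with `r` rows has exactly `γ * r` rows
satisfying `P` in every outcome. -/
def HasExactRows (k j : ℕ) (P : (Fin k → Bool) → Bool) (γ : ℚ) (r : ℕ) : Prop :=
  0 < r ∧ ∃ θ : (Fin r × Fin k → Bool) → ℝ, IsDist θ ∧ kwiseUniform j θ ∧
    ∀ M : Fin r × Fin k → Bool, θ M ≠ 0 →
      ((Finset.univ.filter fun l : Fin r => P (fun i => M (l, i)) = true).card : ℝ) = γ * r

theorem sum_count_mul_ite {k : ℕ} (P : (Fin k → Bool) → Bool) (S : Multiset (Fin k → Bool)) :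
    ∑ x, (S.count x : ℝ) * (if P x = true then 1 else 0) =
      Multiset.card (S.filter fun x => P x = true) := by
  rw [← Multiset.sum_count_eq_card (s := Finset.univ) fun a _ => Finset.mem_univ a]
  push_cast
  refine Finset.sum_congr rfl fun x _ => ?_
  rw [Multiset.count_filter]
  split_ifs <;> simp

theorem exists_hasExactRows {k j : ℕ} {P : (Fin k → Bool) → Bool} {S : Multiset (Fin k → Bool)}
    (hS : S ≠ 0)
    (hν : kwiseUniform j
      (fun x : Fin k → Bool => (S.count x : ℝ) / (Multiset.card S : ℝ)))
    {γ : ℚ}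
    (hγ : ((Finset.univ.filter fun x : Fin k → Bool => P x = true).card : ℝ) / 2 ^ k ≤ γ)
    (hγβ : (γ : ℝ) <
      (Multiset.card (S.filter fun x => P x = true) : ℝ) / (Multiset.card S : ℝ)) :
    ∃ r, HasExactRows k j P γ r := by
  set p : ℕ := (Finset.univ.filter fun x : Fin k → Bool => P x = true).card with hp
  set F : ℕ := Multiset.card (S.filter fun x => P x = true) with hF
  set a : ℕ := Multiset.card S with ha
  have ha0 : (0 : ℝ) < a := by
    exact_mod_cast Multiset.card_pos.mpr hS
  set q : ℝ := (2 : ℝ) ^ k with hq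
  have hq1 : 1 ≤ q := one_le_pow₀ (by norm_num)
  have hq0 : 0 < q := by linarith
  have hcard : (Fintype.card (Fin k → Bool) : ℝ) = q := by simp [hq]
  set β : ℝ := (F : ℝ) / a with hβ
  set u : ℝ := (p : ℝ) / q with hu
  have hu0 : 0 ≤ u := by positivity
  have hFa : F ≤ a := Multiset.card_le_card (Multiset.filter_le _ _)
  have hβ1 : β ≤ 1 := by
    rw [hβ, div_le_one ha0]
    exact_mod_cast hFa
  have hpsum : ∑ x : Fin k → Bool, (if P x = true then (1 : ℝ) else 0) = p := by
    simp [hp]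
  have hpq : (p : ℝ) ≤ q := by
    rw [← hcard]
    exact_mod_cast Finset.card_le_univ _
  have h1 : ∃ x, P x = true := by
    by_contra! hc
    have : F = 0 := by
      rw [hF, Multiset.filter_eq_nil.mpr fun x _ => hc x, Multiset.card_zero]
    rw [this, Nat.cast_zero, zero_div] at hβ
    linarith
  have h0 : ∃ x, P x = false := by
    by_contra! hc
    have : (p : ℝ) = q := by
      rw [← hpsum, ← hcard]
      simp [hc]
    rw [this, div_self hq0.ne'] at hu
    linarith
  have hlt : a * p < 2 ^ k * F := by
    have h2 : u < β := lt_of_le_of_lt hγ hγβ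
    rw [hu, hβ, div_lt_div_iff₀ hq0 ha0] at h2
    have h3 : ((a * p : ℕ) : ℝ) < ((2 ^ k * F : ℕ) : ℝ) := by
      push_cast
      linarith
    exact_mod_cast h3
  obtain ⟨D, hD⟩ : ∃ D : ℕ, 2 ^ k * F = a * p + D := Nat.exists_eq_add_of_le hlt.le
  have : NeZero D := ⟨by omega⟩
  have hDR : (D : ℝ) = q * a * (β - u) := by
    have h2 : ((2 ^ k * F : ℕ) : ℝ) = ((a * p + D : ℕ) : ℝ) := by rw [hD]
    push_cast at h2
    rw [hβ, hu]
    field_simp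
    linarith
  set η : ℝ := (β - γ) / (2 * q ^ 2) with hη
  have hη0 : 0 < η := div_pos (by linarith) (by positivity)
  have hη1 : η ≤ 1 := by
    rw [hη, div_le_one (by positivity)]
    nlinarith
  obtain ⟨R, hR⟩ := Filter.eventually_atTop.mp (eventually_exists_weight k j P h1 h0 D hη0 hη1)
  set r : ℕ := γ.den * (R + 1) with hr
  have hrR : R ≤ r := (Nat.le_succ R).trans (Nat.le_mul_of_pos_left _ γ.den_pos)
  have hr0 : 0 < r := Nat.mul_pos γ.den_pos (Nat.succ_pos R)
  set m : ℕ := γ.num.toNat * (R + 1) with hm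
  have hγ0 : 0 ≤ γ := by
    have : (0 : ℝ) ≤ γ := hu0.trans hγ
    exact_mod_cast this
  have hmr : (m : ℝ) = γ * r := by
    have h2 : ((γ.num.toNat : ℤ) : ℚ) = γ * γ.den := by
      rw [Int.toNat_of_nonneg (Rat.num_nonneg.mpr hγ0), Rat.mul_den_eq_num]
    have h3 : (γ.num.toNat : ℝ) = γ * γ.den := by exact_mod_cast h2
    rw [hm, hr]
    push_cast
    rw [h3]
    ring
  obtain ⟨w, hw0, hwsupp, hw⟩ := hR r hrR (m : ZMod D)
  let δ : (Fin k → Bool) → ℤ := fun x => 2 ^ k * S.count x - a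
  have hδ : ∀ (f : (Fin k → Bool) → ℝ) (T : Finset (Fin k)), DependsOn f (T : Set (Fin k)) →
      T.card ≤ j → ∑ x, (δ x : ℝ) * f x = 0 := by
    intro f T hf hT
    have h2 := hν.sum_mul_eq hf hT
    have h3 : ∑ x, (δ x : ℝ) * f x =
        a * (q * ∑ x, (S.count x : ℝ) / a * f x - ∑ x, f x) := by
      rw [mul_sub, Finset.mul_sum, Finset.mul_sum, Finset.mul_sum, ← Finset.sum_sub_distrib]
      refine Finset.sum_congr rfl fun x _ => ?_
      simp only [δ]
      push_cast
      field_simp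
      rw [hq]
      ring
    rw [h3, h2, sub_self, mul_zero]
  have hδP : ∑ x, (δ x : ℝ) * (if P x = true then 1 else 0) = D := by
    have h2 : ∑ x, (δ x : ℝ) * (if P x = true then 1 else 0) =
        q * ∑ x, (S.count x : ℝ) * (if P x = true then 1 else 0) -
          a * ∑ x, (if P x = true then (1 : ℝ) else 0) := by
      rw [Finset.mul_sum, Finset.mul_sum, ← Finset.sum_sub_distrib]
      refine Finset.sum_congr rfl fun x _ => ?_
      simp only [δ]
      push_cast
      ring
    have h3 : ((2 ^ k * F : ℕ) : ℝ) = ((a * p + D : ℕ) : ℝ) := by rw [hD]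
    push_cast at h3
    rw [h2, sum_count_mul_ite, hpsum]
    linarith
  obtain ⟨θ, hθ, hθu, hθm⟩ := exists_kwiseUniform_of_rearrangement hw0 hw P m fun M hM => by
    obtain ⟨hres, hwin⟩ := hwsupp M hM
    obtain ⟨z, hz⟩ : (D : ℤ) ∣ (m : ℤ) - rowCount P M := by
      rw [← ZMod.intCast_eq_intCast_iff_dvd_sub]
      exact_mod_cast hres
    have hzR : z * (q * a * (β - u)) = γ * r - rowCount P M := by
      rw [← hDR, ← hmr]
      have : ((m : ℤ) - rowCount P M : ℝ) = ((D * z : ℤ) : ℝ) := by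
        rw [← hz]
        push_cast
        rfl
      push_cast at this
      linarith
    set n : (Fin k → Bool) → ℕ := fun x => rowCount (fun y => decide (y = x)) M with hn
    have hrows : ∀ f : (Fin k → Bool) → ℝ, ∑ l, f (M l) = ∑ x, n x * f x :=
      sum_comp_eq_sum_rowCount M
    have hcP : (rowCount P M : ℝ) = ∑ x, n x * (if P x = true then (1 : ℝ) else 0) := by
      rw [rowCount_eq_sum, ← hrows]
    have hcN : (r : ℝ) - rowCount P M = ∑ x, n x * (1 - if P x = true then (1 : ℝ) else 0) := by
      rw [rowCount_eq_sum, ← hrows fun x => 1 - if P x = true then (1 : ℝ) else 0]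
      simp
    have hr0' : (0 : ℝ) ≤ r := Nat.cast_nonneg r
    have hηr : 0 ≤ η * r := mul_nonneg hη0.le hr0'
    have hc1 : (u - q * η) * r ≤ rowCount P M := by
      calc (u - q * η) * r ≤ (1 / q - η) * r * p := by
            have h2 : (1 / q - η) * r * p = u * r - η * r * p := by
              rw [hu]
              ring
            nlinarith
        _ = ∑ x : Fin k → Bool, (1 / q - η) * r * (if P x = true then (1 : ℝ) else 0) := by
            rw [← Finset.mul_sum, hpsum]
        _ ≤ _ := by
            rw [hcP]
            refine Finset.sum_le_sum fun x _ => mul_le_mul_of_nonneg_right (hwin x) ?_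
            split_ifs <;> norm_num
    have hc2 : rowCount P M ≤ (u + q * η) * r := by
      have h2 : (1 / q - η) * r * (q - p) ≤ r - rowCount P M := by
        calc (1 / q - η) * r * (q - p) =
            ∑ x : Fin k → Bool, (1 / q - η) * r * (1 - if P x = true then (1 : ℝ) else 0) := by
              rw [← Finset.mul_sum, Finset.sum_sub_distrib, hpsum, ← hcard]
              simp
          _ ≤ _ := by
              rw [hcN]
              refine Finset.sum_le_sum fun x _ => mul_le_mul_of_nonneg_right (hwin x) ?_
              split_ifs <;> norm_num
      have h3 : (1 / q - η) * r * (q - p) = r - u * r - η * r * (q - p) := by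
        rw [hu]
        field_simp
      have h4 : 0 ≤ η * r * p := mul_nonneg hηr (Nat.cast_nonneg p)
      nlinarith
    have hnn : ∀ x, 0 ≤ (n x : ℤ) + z * δ x := by
      intro x
      have hcx : (S.count x : ℝ) ≤ a := by exact_mod_cast Multiset.count_le_card x S
      have h2 : (δ x : ℝ) = q * S.count x - a := by
        simp only [δ]
        push_cast
        rfl
      have h3 : (0 : ℝ) ≤ n x + z * δ x := by
        refine shifted_multiplicity_nonneg hq1 hu0 hγ hγβ hβ1 hη hr0' (hwin x) hc1 hc2 hzR
          ?_ ?_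
        · rw [h2]
          have : 0 ≤ q * S.count x := by positivity
          linarith
        · rw [h2]
          nlinarith
      exact_mod_cast h3
    choose n' hn' using fun x => Int.eq_ofNat_of_zero_le (hnn x)
    have hn'R : ∀ x, (n' x : ℝ) = n x + z * δ x := by
      intro x
      have := hn' x
      exact_mod_cast this.symm
    have hshift : ∀ f : (Fin k → Bool) → ℝ,
        ∑ x, n' x * f x = ∑ l, f (M l) + z * ∑ x, (δ x : ℝ) * f x := by
      intro f
      rw [hrows, Finset.mul_sum, ← Finset.sum_add_distrib]
      refine Finset.sum_congr rfl fun x _ => ?_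
      rw [hn'R]
      ring
    have hn'sum : ∑ x, n' x = r := by
      have h2 := hshift fun _ => 1
      rw [hδ (fun _ => 1) ∅ (fun _ _ _ => rfl) (by simp)] at h2
      simp only [mul_one, Finset.sum_const, Finset.card_univ, Fintype.card_fin, nsmul_eq_mul,
        mul_zero, add_zero] at h2
      exact_mod_cast h2
    obtain ⟨M', hM'⟩ := exists_sum_comp_eq n' hn'sum
    refine ⟨M', ?_, fun f T hf hT => ?_⟩
    · have h2 : (rowCount P M' : ℝ) = m := by
        rw [rowCount_eq_sum, hM' fun x => if P x = true then 1 else 0, hshift, hδP,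
          ← rowCount_eq_sum, hmr]
        rw [← hDR] at hzR
        linarith
      exact_mod_cast h2
    · rw [hM' f, hshift, hδ f T hf hT, mul_zero, add_zero]
  refine ⟨r, hr0, θ, hθ, hθu, fun M hM => ?_⟩
  rw [hθm M hM, hmr]

/-- A fully uniform distribution gives `P` its uniform expectation. -/
theorem card_filter_div_card_eq_of_kwiseUniform {k j : ℕ} (hkj : k ≤ j)
    (P : (Fin k → Bool) → Bool) {S : Multiset (Fin k → Bool)}
    (hν : kwiseUniform j
      (fun x : Fin k → Bool => (S.count x : ℝ) / (Multiset.card S : ℝ))) :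
    (Multiset.card (S.filter fun x => P x = true) : ℝ) / (Multiset.card S : ℝ) =
      ((Finset.univ.filter fun x : Fin k → Bool => P x = true).card : ℝ) / 2 ^ k := by
  have h1 := hν.sum_mul_eq (f := fun x => if P x = true then (1 : ℝ) else 0) (T := Finset.univ)
    (fun x y h => by
      rw [show x = y from funext fun i => h i (by simp)])
    (by simpa using hkj)
  rw [Finset.sum_boole] at h1
  rw [← h1, mul_div_cancel_left₀ _ (by positivity), ← sum_count_mul_ite, Finset.sum_div]
  exact Finset.sum_congr rfl fun x _ => by ring

open Classical in
/-- A bound, uniform in `P`, `j < k` and `i ≤ N`, for the number of rows realising `i / N`. -/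
theorem exists_bound_hasExactRows (k N : ℕ) :
    ∃ C : ℕ, ∀ (P : (Fin k → Bool) → Bool) (j i : ℕ), j < k → i ≤ N →
      (∃ r, HasExactRows k j P ((i : ℚ) / N) r) →
        ∃ r, r ≤ C ∧ HasExactRows k j P ((i : ℚ) / N) r := by
  let R : ((Fin k → Bool) → Bool) × Fin k × Fin (N + 1) → ℕ := fun x =>
    if h : ∃ r, HasExactRows k x.2.1 x.1 ((x.2.2 : ℚ) / N) r then h.choose else 0
  refine ⟨∑ x, R x, fun P j i hj hi h => ⟨h.choose, ?_, h.choose_spec⟩⟩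
  have hR : R (P, ⟨j, hj⟩, ⟨i, Nat.lt_succ_of_le hi⟩) = h.choose := dif_pos h
  rw [← hR]
  exact Finset.single_le_sum (f := R) (fun _ _ => Nat.zero_le _) (Finset.mem_univ _)

/-- a (t-1)-wise uniform distribution with E[P] = β (given by a multiset S) can be
turned into a (t-1)-wise uniform distribution on r×k matrices every outcome of which satisfies P
in exactly (β - ε̃)·r of its r rows. -/
theorem stmt8 (k : ℕ) :
    ∀ ε : ℝ, 0 < ε →
      ∃ C : ℝ, 0 < C ∧
        ∀ (t : ℕ), 2 ≤ t →
          ∀ (P : (Fin k → Bool) → Bool) (S : Multiset (Fin k → Bool)) (β : ℝ),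
            S ≠ 0 →
            -- ν(x) = Pr_{s∼S}[s = x] is (t-1)-wise uniform
            kwiseUniform (t - 1)
              (fun x : Fin k → Bool => (S.count x : ℝ) / (Multiset.card S : ℝ)) →
            -- E_{x∼ν}[P(x)] = β
            ((Multiset.card (S.filter fun x => P x = true) : ℝ) / (Multiset.card S : ℝ) = β) →
            -- β exceeds the expectation of P under the uniform distribution
            ((Finset.univ.filter fun x : Fin k → Bool => P x = true).card : ℝ) / 2 ^ k < β →
            ∃ (r : ℕ) (εt : ℚ),
              0 < r ∧ (r : ℝ) ≤ C * (Multiset.card S : ℝ) ^ 4 ∧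
              0 ≤ (εt : ℝ) ∧ (εt : ℝ) ≤ ε ∧
              ∃ θ : (Fin r × Fin k → Bool) → ℝ,
                IsDist θ ∧ kwiseUniform (t - 1) θ ∧
                ∀ M : Fin r × Fin k → Bool, θ M ≠ 0 →
                  ((Finset.univ.filter fun l : Fin r =>
                      P (fun i => M (l, i)) = true).card : ℝ) = (β - (εt : ℝ)) * r := by
  intro ε hε
  obtain ⟨n, hn⟩ := exists_nat_gt (1 / ε)
  have hn0 : (0 : ℝ) < n := (by positivity : (0 : ℝ) < 1 / ε).trans hn
  set N : ℕ := 2 ^ k * n with hN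
  have hNR : (N : ℝ) = 2 ^ k * n := by
    rw [hN]
    push_cast
    rfl
  have hN0 : (0 : ℝ) < N := by
    rw [hNR]
    positivity
  have hNε : 1 / (N : ℝ) ≤ ε := by
    have h1 : (n : ℝ) ≤ N := by
      rw [hNR]
      exact le_mul_of_one_le_left hn0.le (one_le_pow₀ (by norm_num))
    rw [div_le_comm₀ hN0 hε]
    exact hn.le.trans h1
  obtain ⟨C, hC⟩ := exists_bound_hasExactRows k N
  refine ⟨C + 1, by positivity, fun t _ P S β hS hν hβ hlt => ?_⟩
  have hj : t - 1 < k := by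
    by_contra! hkj
    rw [← hβ, card_filter_div_card_eq_of_kwiseUniform hkj P hν] at hlt
    exact lt_irrefl _ hlt
  have hS1 : (1 : ℝ) ≤ Multiset.card S := by
    exact_mod_cast Multiset.card_pos.mpr hS
  have hβ1 : β ≤ 1 := by
    rw [← hβ, div_le_one (by linarith)]
    exact_mod_cast Multiset.card_le_card (Multiset.filter_le _ _)
  have hβ0 : 0 < β := lt_of_le_of_lt (by positivity) hlt
  have hceil : 0 < ⌈β * N⌉₊ := Nat.ceil_pos.mpr (mul_pos hβ0 hN0)
  obtain ⟨i, hi⟩ : ∃ i, ⌈β * N⌉₊ = i + 1 := Nat.exists_eq_succ_of_ne_zero hceil.ne'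
  have hi1 : (i : ℝ) < β * N := Nat.lt_ceil.mp (by omega)
  have hi2 : β * N ≤ i + 1 := by
    have := Nat.le_ceil (β * N)
    rw [hi] at this
    exact_mod_cast this
  have hiN : i ≤ N := by
    have : (i : ℝ) ≤ N := hi1.le.trans (mul_le_of_le_one_left hN0.le hβ1)
    exact_mod_cast this
  have hγ : (((i : ℚ) / N : ℚ) : ℝ) = i / N := by push_cast; rfl
  have hγβ : (i : ℝ) / N < β := (div_lt_iff₀ hN0).mpr hi1
  have huγ : ((Finset.univ.filter fun x : Fin k → Bool => P x = true).card : ℝ) / 2 ^ k ≤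
      i / N := by
    set p := (Finset.univ.filter fun x : Fin k → Bool => P x = true).card
    have h1 : ((p * n : ℕ) : ℝ) < β * N := by
      rw [div_lt_iff₀ (by positivity)] at hlt
      rw [hNR]
      push_cast
      nlinarith
    have h2 : p * n ≤ i := by
      have := Nat.lt_ceil.mpr h1
      omega
    have h3 : (p : ℝ) * n ≤ i := by exact_mod_cast h2
    rw [div_le_div_iff₀ (by positivity) hN0, hNR]
    nlinarith [pow_pos (two_pos : (0 : ℝ) < 2) k]
  obtain ⟨r, hrC, hr0, θ, hθ, hθu, hθP⟩ := hC P (t - 1) i hj hiN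
    (exists_hasExactRows hS hν (by rw [hγ]; exact huγ) (by rw [hγ, hβ]; exact hγβ))
  have hεt : (((Multiset.card (S.filter fun x => P x = true) : ℚ) / Multiset.card S - i / N : ℚ) :
      ℝ) = β - i / N := by
    rw [← hβ]
    push_cast
    rfl
  refine ⟨r, (Multiset.card (S.filter fun x => P x = true) : ℚ) / Multiset.card S - i / N, hr0,
    ?_, ?_, ?_, θ, hθ, hθu, fun M hM => ?_⟩
  · have h1 : (r : ℝ) ≤ C := by exact_mod_cast hrC
    have h2 : (1 : ℝ) ≤ (Multiset.card S : ℝ) ^ 4 := one_le_pow₀ hS1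
    nlinarith
  · rw [hεt]
    linarith
  · rw [hεt]
    refine le_trans ?_ hNε
    rw [sub_le_iff_le_add, ← add_div, le_div_iff₀ hN0]
    linarith
  · rw [hθP M hM, hεt, hγ]
    ring
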